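/- arXiv:math-ph/0405023 — 3 statements merged into one kernel-verified Lean document; each statement's English description precedes it below -/
import Mathlib

section
/- Let θ>0 with θ/(2π) irrational, and let H be a self-adjoint element of the C*-subalgebra of bounded operators on L²(ℝ) generated by the Weyl operators {𝔚(√θ·m) : m∈ℤ²}. Then H has no cyclic vector: for every ψ∈L²(ℝ), the closure of the linear span of {Hⁿψ : n∈ℕ} is a proper subspace of L²(ℝ). Moreover H has infinite multiplicity: for every finite family ψ₁,…,ψ_k∈L²(ℝ), the closure of the linear span of {Hⁿψⱼ : n∈ℕ, 1≤j≤k} is a proper subspace of L²(ℝ). -/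
open MeasureTheory Real

section LinearAlgebra

/-- A matrix over a field whose entries satisfy the identity below has rank at most one. -/
theorem Matrix.exists_eq_vecMulVec_of_entries {K ι : Type*} [Field K] (X : Matrix ι ι K)
    (hX : ∀ p q r s t u, X p q * X r s * X t u = X p s * X t q * X r u) :
    ∃ v w : ι → K, X = Matrix.vecMulVec v w := by
  by_cases h : X = 0
  · exact ⟨0, 0, by simp [h]⟩
  · obtain ⟨a, b, hab⟩ : ∃ a b, X a b ≠ 0 := by
      by_contra! hc
      exact h (Matrix.ext hc)
    refine ⟨fun r => X r b, fun s => (X a b)⁻¹ * X a s, ?_⟩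
    ext r s
    have h1 := hX a b r s a b
    rw [Matrix.vecMulVec_apply]
    field_simp
    exact mul_left_cancel₀ hab (by linear_combination h1)

theorem card_le_of_sum_eq_smul_one {R : Type*} [CommRing R] {e : R} (he : IsIdempotentElem e)
    (he0 : e ≠ 0) {n k : ℕ} (X : Fin k → Matrix (Fin n) (Fin n) R)
    (hX : ∀ j p q r s t u, X j p q * X j r s * X j t u = X j p s * X j t q * X j r u)
    (hsum : ∀ p q, ∑ j, X j p q = if p = q then e else 0) : n ≤ k := by
  obtain ⟨P, hP, -, heP⟩ :=
    Ideal.exists_le_prime_notMem_of_isIdempotentElem (⊥ : Ideal R) e he (by simpa using he0)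
  let f : R →+* FractionRing (R ⧸ P) := (algebraMap (R ⧸ P) _).comp (Ideal.Quotient.mk P)
  have hfe : f e = 1 := by
    have h0 : f e ≠ 0 := by
      intro h
      refine heP (Ideal.Quotient.eq_zero_iff_mem.1 ?_)
      exact IsFractionRing.injective (R ⧸ P) (FractionRing (R ⧸ P)) (by simpa [f] using h)
    exact mul_left_cancel₀ h0 (by rw [← map_mul, he.eq, mul_one])
  have hv : ∀ j, ∃ v w : Fin n → FractionRing (R ⧸ P),
      (X j).map f = Matrix.vecMulVec v w := fun j =>
    Matrix.exists_eq_vecMulVec_of_entries _ fun p q r s t u => by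
      simp only [Matrix.map_apply, ← map_mul, hX j p q r s t u]
  choose v w hvw using hv
  have h1 : (1 : Matrix (Fin n) (Fin n) (FractionRing (R ⧸ P))) =
      (Matrix.of fun p j => v j p : Matrix (Fin n) (Fin k) _) * Matrix.of w := by
    ext p q
    have h2 := congrArg f (hsum p q)
    rw [map_sum] at h2
    rw [Matrix.mul_apply, Matrix.one_apply]
    trans f (if p = q then e else 0)
    · split_ifs <;> simp [hfe]
    · rw [← h2]
      refine Finset.sum_congr rfl fun j _ => ?_
      exact congrFun (congrFun (hvw j) p) q
  calc n = (1 : Matrix (Fin n) (Fin n) (FractionRing (R ⧸ P))).rank := by simp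
    _ ≤ _ := by rw [h1]; exact Matrix.rank_mul_le_left _ _
    _ ≤ k := Matrix.rank_le_width _

end LinearAlgebra

section Commutant

variable {E : Type*} [NormedAddCommGroup E] [InnerProductSpace ℂ E] [CompleteSpace E]
  (𝒜 : StarSubalgebra ℂ (E →L[ℂ] E))

/-- The closed cyclic subspace generated by `φ` under the operator algebra `𝒜`. -/
noncomputable def cyclicSubspace (φ : E) : Submodule ℂ E :=
  (𝒜.toSubalgebra.toSubmodule.map
    (ContinuousLinearMap.apply ℂ E φ).toLinearMap).topologicalClosure

instance (φ : E) : CompleteSpace (cyclicSubspace 𝒜 φ) :=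
  (Submodule.isClosed_topologicalClosure _).completeSpace_coe

/-- The orthogonal projection onto the cyclic subspace generated by `φ`. -/
noncomputable def cyclicProj (φ : E) : E →L[ℂ] E :=
  (cyclicSubspace 𝒜 φ).starProjection

/-- The commutant of `𝒜`. -/
noncomputable abbrev commutant : StarSubalgebra ℂ (E →L[ℂ] E) :=
  StarSubalgebra.centralizer ℂ (𝒜 : Set (E →L[ℂ] E))

variable {𝒜}

theorem mem_commutant_iff {T : E →L[ℂ] E} : T ∈ commutant 𝒜 ↔ ∀ a ∈ 𝒜, a * T = T * a := by
  rw [StarSubalgebra.mem_centralizer_iff]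
  exact ⟨fun h a ha => (h a ha).1, fun h a ha => ⟨h a ha, h _ (star_mem ha)⟩⟩

theorem commutant_apply {T a : E →L[ℂ] E} (hT : T ∈ commutant 𝒜) (ha : a ∈ 𝒜) (x : E) :
    T (a x) = a (T x) :=
  (DFunLike.congr_fun (mem_commutant_iff.1 hT a ha) x).symm

theorem inner_star_apply (T : E →L[ℂ] E) (x y : E) : inner ℂ (star T x) y = inner ℂ x (T y) := by
  rw [ContinuousLinearMap.star_eq_adjoint, ContinuousLinearMap.adjoint_inner_left]

theorem inner_apply_star (T : E →L[ℂ] E) (x y : E) : inner ℂ x (star T y) = inner ℂ (T x) y := by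
  rw [ContinuousLinearMap.star_eq_adjoint, ContinuousLinearMap.adjoint_inner_right]

theorem mem_cyclicSubspace_iff {φ x : E} :
    x ∈ cyclicSubspace 𝒜 φ ↔ x ∈ closure ((fun a : E →L[ℂ] E => a φ) '' 𝒜) :=
  Iff.rfl

theorem apply_mem_cyclicSubspace {a : E →L[ℂ] E} (ha : a ∈ 𝒜) (φ : E) :
    a φ ∈ cyclicSubspace 𝒜 φ :=
  subset_closure ⟨a, ha, rfl⟩

theorem self_mem_cyclicSubspace (φ : E) : φ ∈ cyclicSubspace 𝒜 φ :=
  apply_mem_cyclicSubspace (one_mem 𝒜) φ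

theorem cyclicSubspace_induction {φ : E} {s : Set E} (hs : IsClosed s)
    (h : ∀ a ∈ 𝒜, a φ ∈ s) {x : E} (hx : x ∈ cyclicSubspace 𝒜 φ) : x ∈ s := by
  refine hs.closure_subset_iff.2 ?_ (mem_cyclicSubspace_iff.1 hx)
  rintro _ ⟨a, ha, rfl⟩
  exact h a ha

theorem cyclicProj_apply_mem (φ x : E) : cyclicProj 𝒜 φ x ∈ cyclicSubspace 𝒜 φ :=
  Submodule.starProjection_apply_mem _ _

theorem cyclicProj_eq_self {φ x : E} (hx : x ∈ cyclicSubspace 𝒜 φ) : cyclicProj 𝒜 φ x = x :=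
  Submodule.starProjection_eq_self_iff.2 hx

theorem cyclicProj_mul_self (φ : E) : cyclicProj 𝒜 φ * cyclicProj 𝒜 φ = cyclicProj 𝒜 φ :=
  Submodule.isIdempotentElem_starProjection _

theorem star_cyclicProj (φ : E) : star (cyclicProj 𝒜 φ) = cyclicProj 𝒜 φ :=
  isSelfAdjoint_starProjection _

theorem mul_cyclicProj_eq {a : E →L[ℂ] E} (ha : a ∈ 𝒜) (φ : E) :
    cyclicProj 𝒜 φ * a * cyclicProj 𝒜 φ = a * cyclicProj 𝒜 φ := by
  ext x
  refine cyclicProj_eq_self ?_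
  refine cyclicSubspace_induction (s := a ⁻¹' (cyclicSubspace 𝒜 φ))
    ((Submodule.isClosed_topologicalClosure _).preimage a.continuous)
    (fun b hb => apply_mem_cyclicSubspace (mul_mem ha hb) φ) (cyclicProj_apply_mem φ x)

theorem cyclicProj_mem_commutant (φ : E) : cyclicProj 𝒜 φ ∈ commutant 𝒜 := by
  refine mem_commutant_iff.2 fun a ha => ?_
  have h := congrArg star (mul_cyclicProj_eq (star_mem ha) φ)
  simp only [star_mul, star_star, star_cyclicProj] at h
  rw [← h, ← mul_assoc, mul_cyclicProj_eq ha]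

theorem mul_cyclicProj_eq_zero {T : E →L[ℂ] E} (hT : T ∈ commutant 𝒜) {φ : E} (h : T φ = 0) :
    T * cyclicProj 𝒜 φ = 0 := by
  ext x
  exact cyclicSubspace_induction (s := T ⁻¹' {0}) (isClosed_singleton.preimage T.continuous)
    (fun a ha => by simp [commutant_apply hT ha, h]) (cyclicProj_apply_mem φ x)

theorem eq_zero_of_mem_cyclicSubspace {φ x : E} (hx : x ∈ cyclicSubspace 𝒜 φ)
    (h : ∀ a ∈ 𝒜, inner ℂ (a φ) x = 0) : x = 0 := by
  rw [← inner_self_eq_zero (𝕜 := ℂ)]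
  exact cyclicSubspace_induction (s := {y | inner ℂ y x = 0})
    (isClosed_singleton.preimage (by fun_prop : Continuous fun y => inner ℂ y x)) h hx

theorem cyclicProj_mul_mul_eq_zero {T : E →L[ℂ] E} (hT : T ∈ commutant 𝒜) {φ : E}
    (h : ∀ a ∈ 𝒜, inner ℂ (a φ) (T φ) = 0) : cyclicProj 𝒜 φ * T * cyclicProj 𝒜 φ = 0 := by
  refine mul_cyclicProj_eq_zero (mul_mem (cyclicProj_mem_commutant φ) hT) ?_
  refine eq_zero_of_mem_cyclicSubspace (cyclicProj_apply_mem φ _) fun a ha => ?_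
  change inner ℂ (a φ) (cyclicProj 𝒜 φ (T φ)) = 0
  rw [← inner_star_apply, star_cyclicProj, cyclicProj_eq_self (apply_mem_cyclicSubspace ha φ),
    h a ha]

theorem exists_seq_of_mem_cyclicSubspace {φ x : E} (hx : x ∈ cyclicSubspace 𝒜 φ) :
    ∃ a : ℕ → E →L[ℂ] E, (∀ n, a n ∈ 𝒜) ∧
      Filter.Tendsto (fun n => a n φ) Filter.atTop (nhds x) := by
  obtain ⟨u, hu, hlim⟩ := mem_closure_iff_seq_limit.1 (mem_cyclicSubspace_iff.1 hx)
  choose a ha hau using hu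
  exact ⟨a, ha, by simpa [hau] using hlim⟩

theorem norm_star_apply_eq (hcomm : ∀ a ∈ 𝒜, ∀ b ∈ 𝒜, a * b = b * a) {a : E →L[ℂ] E} (ha : a ∈ 𝒜)
    (x : E) : ‖star a x‖ = ‖a x‖ := by
  have h : inner ℂ (star a x) (star a x) = inner ℂ (a x) (a x) := by
    rw [inner_star_apply, ← inner_apply_star a]
    exact congrArg _ (DFunLike.congr_fun (hcomm a ha _ (star_mem ha)) x)
  rw [@norm_eq_sqrt_re_inner ℂ, @norm_eq_sqrt_re_inner ℂ, h]

theorem inner_star_apply_comm (hcomm : ∀ a ∈ 𝒜, ∀ b ∈ 𝒜, a * b = b * a) {T S : E →L[ℂ] E}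
    (hT : T ∈ commutant 𝒜) (hS : S ∈ commutant 𝒜) {φ : E}
    (hTφ : T φ ∈ cyclicSubspace 𝒜 φ) (hSφ : S φ ∈ cyclicSubspace 𝒜 φ) :
    inner ℂ (star T φ) (S φ) = inner ℂ (star S φ) (T φ) := by
  obtain ⟨a, ha, ha'⟩ := exists_seq_of_mem_cyclicSubspace hSφ
  obtain ⟨b, hb, hb'⟩ := exists_seq_of_mem_cyclicSubspace hTφ
  have h1 : Filter.Tendsto (fun n => inner ℂ (star T φ) (a n φ)) Filter.atTop
      (nhds (inner ℂ (star T φ) (S φ))) := tendsto_const_nhds.inner ha'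
  have h2 : Filter.Tendsto (fun n => inner ℂ (star S φ) (b n φ)) Filter.atTop
      (nhds (inner ℂ (star S φ) (T φ))) := tendsto_const_nhds.inner hb'
  have h3 : ∀ n, inner ℂ (star T φ) (a n φ) - inner ℂ (star S φ) (b n φ) =
      inner ℂ (star (a n) φ) (T φ - b n φ) - inner ℂ (star (b n) φ) (S φ - a n φ) := by
    intro n
    have e : a n (b n φ) = b n (a n φ) := DFunLike.congr_fun (hcomm _ (ha n) _ (hb n)) φ
    simp only [inner_sub_right, inner_star_apply, commutant_apply hT (ha n),
      commutant_apply hS (hb n), e]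
    ring
  have aux : ∀ (c : ℕ → E →L[ℂ] E) (d : ℕ → E) (y : E), (∀ n, c n ∈ 𝒜) →
      Filter.Tendsto (fun n => c n φ) Filter.atTop (nhds y) →
      Filter.Tendsto d Filter.atTop (nhds 0) →
      Filter.Tendsto (fun n => inner ℂ (star (c n) φ) (d n)) Filter.atTop (nhds 0) := by
    intro c d y hc hcy hd
    refine squeeze_zero_norm (a := fun n => ‖c n φ‖ * ‖d n‖) (fun n => ?_) ?_
    · rw [← norm_star_apply_eq hcomm (hc n)]
      exact norm_inner_le_norm _ _
    · simpa using hcy.norm.mul hd.norm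
  have h4 := (aux a (fun n => T φ - b n φ) _ ha ha' (by simpa using hb'.const_sub (T φ))).sub
    (aux b (fun n => S φ - a n φ) _ hb hb' (by simpa using ha'.const_sub (S φ)))
  simp only [← h3, sub_zero] at h4
  exact sub_eq_zero.1 (tendsto_nhds_unique (h1.sub h2) h4)

theorem cyclicProj_corner_comm (hcomm : ∀ a ∈ 𝒜, ∀ b ∈ 𝒜, a * b = b * a) {T S : E →L[ℂ] E}
    (hT : T ∈ commutant 𝒜) (hS : S ∈ commutant 𝒜) (φ : E) :
    cyclicProj 𝒜 φ * T * cyclicProj 𝒜 φ * S * cyclicProj 𝒜 φ =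
      cyclicProj 𝒜 φ * S * cyclicProj 𝒜 φ * T * cyclicProj 𝒜 φ := by
  set Q := cyclicProj 𝒜 φ with hQ
  have hQm : Q ∈ commutant 𝒜 := cyclicProj_mem_commutant φ
  have hQQ : Q * Q = Q := cyclicProj_mul_self φ
  have hφ : Q φ = φ := cyclicProj_eq_self (self_mem_cyclicSubspace φ)
  have key : Q * (T * Q * S - S * Q * T) * Q = 0 := by
    refine cyclicProj_mul_mul_eq_zero (sub_mem (mul_mem (mul_mem hT hQm) hS)
      (mul_mem (mul_mem hS hQm) hT)) fun a ha => ?_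
    have hT' : Q * T ∈ commutant 𝒜 := mul_mem hQm hT
    have hS' : star a ∈ commutant 𝒜 :=
      mem_commutant_iff.2 fun b hb => hcomm b hb _ (star_mem ha)
    have hmem : ∀ R : E →L[ℂ] E, (Q * R) φ ∈ cyclicSubspace 𝒜 φ := fun R =>
      cyclicProj_apply_mem φ _
    have h := inner_star_apply_comm hcomm hT' (mul_mem (mul_mem hQm hS) hS') (hmem T)
      (by rw [mul_assoc]; exact hmem _)
    rw [inner_star_apply, inner_star_apply] at h
    have hQa : ∀ x y : E, inner ℂ (Q x) y = inner ℂ x (Q y) := fun x y => by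
      rw [← inner_star_apply, star_cyclicProj]
    have h' : inner ℂ φ (T (Q (S (star a φ)))) = inner ℂ φ (S (star a (Q (T φ)))) := by
      simpa [← hQa, hφ] using h
    have hsa := star_mem ha
    rw [commutant_apply hS hsa, commutant_apply hQm hsa, commutant_apply hT hsa,
      commutant_apply hS hsa, inner_apply_star, inner_apply_star] at h'
    simpa [inner_sub_right, sub_eq_zero] using h'
  rw [mul_sub, sub_mul, sub_eq_zero] at key
  simpa only [mul_assoc] using key

/-- Finitely many vectors can be orthogonalized over `𝒜`: the join of the cyclic subspaces is an
orthogonal sum of cyclic subspaces, with no more summands. -/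
theorem exists_sum_cyclicProj (k : ℕ) (ψ : Fin k → E) :
    ∃ η : Fin k → E, IsStarProjection (∑ j, cyclicProj 𝒜 (η j)) ∧
      ∀ i, (∑ j, cyclicProj 𝒜 (η j)) (ψ i) = ψ i := by
  induction k with
  | zero => exact ⟨0, by simp, fun i => i.elim0⟩
  | succ k ih =>
    obtain ⟨η, hP, hη⟩ := ih fun i => ψ i.castSucc
    set P := ∑ j, cyclicProj 𝒜 (η j) with hPdef
    have hPm : P ∈ commutant 𝒜 := sum_mem fun j _ => cyclicProj_mem_commutant _
    set ξ := ψ (Fin.last k) - P (ψ (Fin.last k)) with hξ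
    have hPP : ∀ x, P (P x) = P x := DFunLike.congr_fun hP.isIdempotentElem.eq
    have h1 : P * cyclicProj 𝒜 ξ = 0 := mul_cyclicProj_eq_zero hPm (by simp [hξ, hPP])
    have h2 : cyclicProj 𝒜 ξ * P = 0 := by
      simpa [star_cyclicProj, hP.isSelfAdjoint.star_eq] using congrArg star h1
    have hsum : ∑ j, cyclicProj 𝒜 ((Fin.snoc η ξ : Fin (k + 1) → E) j) = P + cyclicProj 𝒜 ξ := by
      simp [Fin.sum_univ_castSucc, hPdef]
    refine ⟨Fin.snoc η ξ, ?_, ?_⟩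
    · rw [hsum]
      refine ⟨?_, hP.isSelfAdjoint.add (star_cyclicProj ξ)⟩
      rw [IsIdempotentElem, mul_add, add_mul, add_mul, h1, h2, cyclicProj_mul_self,
        hP.isIdempotentElem.eq]
      simp
    · rw [hsum]
      have h3 : ∀ x, cyclicProj 𝒜 ξ (P x) = 0 := DFunLike.congr_fun h2
      refine Fin.lastCases ?_ fun i => ?_
      · have h4 : cyclicProj 𝒜 ξ (ψ (Fin.last k)) = ξ := by
          have h5 := cyclicProj_eq_self (self_mem_cyclicSubspace (𝒜 := 𝒜) ξ)
          conv_lhs at h5 => rw [hξ, map_sub, h3, sub_zero]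
          exact h5
        rw [add_apply, h4, hξ, add_sub_cancel]
      · have h4 : cyclicProj 𝒜 ξ (ψ i.castSucc) = 0 := by rw [← hη i]; exact h3 _
        simp [h4, hη]

/-- If a commutative star algebra of operators has a finite family of `k` vectors separating for
its commutant, then at most `k` isometries in the commutant can move a nonzero cyclic subspace to
mutually orthogonal positions. -/
theorem card_le_of_separating (hcomm : ∀ a ∈ 𝒜, ∀ b ∈ 𝒜, a * b = b * a) {φ : E} (hφ : φ ≠ 0)
    {n : ℕ} (V : Fin n → E →L[ℂ] E) (hV : ∀ p, V p ∈ commutant 𝒜)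
    (hiso : ∀ p, star (V p) * V p = 1)
    (horth : ∀ p q, p ≠ q → ∀ a ∈ 𝒜, inner ℂ (V p φ) (a (V q φ)) = 0)
    {k : ℕ} (ψ : Fin k → E) (hψ : ∀ T ∈ commutant 𝒜, (∀ j, T (ψ j) = 0) → T = 0) : n ≤ k := by
  obtain ⟨η, -, hη⟩ := exists_sum_cyclicProj (𝒜 := 𝒜) k ψ
  have hone : ∑ j, cyclicProj 𝒜 (η j) = 1 := by
    refine sub_eq_zero.1 (hψ _ (sub_mem (sum_mem fun j _ => cyclicProj_mem_commutant _)
      (one_mem _)) fun j => ?_)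
    rw [sub_apply, hη]
    simp
  set Q := cyclicProj 𝒜 φ with hQ
  have hQm : Q ∈ commutant 𝒜 := cyclicProj_mem_commutant φ
  have hQQ : Q * Q = Q := cyclicProj_mul_self φ
  let s : Set (E →L[ℂ] E) := (fun T => Q * T * Q) '' (commutant 𝒜)
  have hs : ∀ x ∈ s, ∀ y ∈ s, x * y = y * x := by
    rintro _ ⟨T, hT, rfl⟩ _ ⟨S, hS, rfl⟩
    have h := cyclicProj_corner_comm hcomm hT hS φ
    have e : ∀ A B : E →L[ℂ] E, Q * A * Q * (Q * B * Q) = Q * A * Q * B * Q := fun A B => by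
      rw [← mul_assoc, ← mul_assoc, mul_assoc (Q * A) Q Q, hQQ]
    simpa only [e] using h
  have hsc := Subring.isMulCommutative_closure hs
  let _ : CommRing (Subring.closure s) :=
    { (inferInstance : Ring (Subring.closure s)) with mul_comm := hsc.is_comm.comm }
  have hmem : ∀ T ∈ commutant 𝒜, Q * T * Q ∈ Subring.closure s := fun T hT =>
    Subring.subset_closure ⟨T, hT, rfl⟩
  have hQs : Q ∈ Subring.closure s := by
    simpa [hQQ] using hmem 1 (one_mem _)
  have hY : ∀ j p q, star (V p) * cyclicProj 𝒜 (η j) * V q ∈ commutant 𝒜 := fun j p q =>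
    mul_mem (mul_mem (star_mem (hV p)) (cyclicProj_mem_commutant _)) (hV q)
  let X : Fin k → Matrix (Fin n) (Fin n) (Subring.closure s) := fun j p q =>
    ⟨Q * (star (V p) * cyclicProj 𝒜 (η j) * V q) * Q, hmem _ (hY j p q)⟩
  refine card_le_of_sum_eq_smul_one (e := (⟨Q, hQs⟩ : Subring.closure s)) (Subtype.ext hQQ) ?_ X
    ?_ ?_
  · intro h
    have h' : Q = 0 := congrArg Subtype.val h
    have h5 := cyclicProj_eq_self (self_mem_cyclicSubspace (𝒜 := 𝒜) φ)
    rw [← hQ, h'] at h5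
    exact hφ h5.symm
  · intro j p q r t u v
    apply Subtype.ext
    set G := cyclicProj 𝒜 (η j) with hG
    change Q * (star (V p) * G * V q) * Q * (Q * (star (V r) * G * V t) * Q) *
        (Q * (star (V u) * G * V v) * Q) =
      Q * (star (V p) * G * V t) * Q * (Q * (star (V u) * G * V q) * Q) *
        (Q * (star (V r) * G * V v) * Q)
    have hC : ∀ a b, V a * Q * star (V b) ∈ commutant 𝒜 := fun a b =>
      mul_mem (mul_mem (hV a) hQm) (star_mem (hV b))
    have h := cyclicProj_corner_comm hcomm (hC q r) (hC t u) (η j)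
    rw [← hG] at h
    have h' := congrArg (fun A => Q * star (V p) * A * (V v * Q)) h
    have hQQ' : ∀ A, Q * (Q * A) = Q * A := fun A => by rw [← mul_assoc, hQQ]
    simp only [mul_assoc, hQQ'] at h' ⊢
    exact h'
  · intro p q
    apply Subtype.ext
    rw [AddSubmonoidClass.coe_finsetSum]
    change ∑ j, Q * (star (V p) * cyclicProj 𝒜 (η j) * V q) * Q = _
    rw [← Finset.sum_mul, ← Finset.mul_sum, ← Finset.sum_mul, ← Finset.mul_sum, hone, mul_one]
    split_ifs with hpq
    · subst hpq
      rw [hiso, mul_one, hQQ]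
    · refine cyclicProj_mul_mul_eq_zero (mul_mem (star_mem (hV p)) (hV q)) fun a ha => ?_
      have h := horth p q hpq _ (star_mem ha)
      rw [inner_apply_star, ← commutant_apply (hV p) ha, ← inner_apply_star] at h
      exact h

end Commutant

section Weyl

/-- The Weyl system on `L²(ℝ)`: `(W(a)ψ)(x) = e^{ia₁a₂/2} e^{ia₂x} ψ(x+a₁)`. -/
def IsWeylSystem (W : ℝ × ℝ → Lp ℂ 2 (volume : Measure ℝ) →L[ℂ] Lp ℂ 2 (volume : Measure ℝ)) :
    Prop :=
  ∀ (a : ℝ × ℝ) (φ : Lp ℂ 2 (volume : Measure ℝ)),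
    (W a φ : ℝ → ℂ) =ᵐ[volume] fun x =>
      Complex.exp (Complex.I * a.1 * a.2 / 2) *
        (Complex.exp (Complex.I * a.2 * x) * (φ : ℝ → ℂ) (x + a.1))

namespace IsWeylSystem

variable {W : ℝ × ℝ → Lp ℂ 2 (volume : Measure ℝ) →L[ℂ] Lp ℂ 2 (volume : Measure ℝ)}

theorem zero (hW : IsWeylSystem W) : W 0 = 1 := by
  ext1 φ
  refine Lp.ext ?_
  filter_upwards [hW 0 φ] with x hx
  simp [hx]

theorem mul (hW : IsWeylSystem W) (a b : ℝ × ℝ) :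
    W a * W b = Complex.exp (Complex.I * (a.1 * b.2 - a.2 * b.1) / 2) • W (a + b) := by
  ext1 φ
  refine Lp.ext ?_
  have h1 := (measurePreserving_add_right (volume : Measure ℝ) a.1).quasiMeasurePreserving.ae
    (hW b φ)
  filter_upwards [hW a (W b φ), hW (a + b) φ, h1,
    Lp.coeFn_smul (Complex.exp (Complex.I * (a.1 * b.2 - a.2 * b.1) / 2)) (W (a + b) φ)]
    with x hx1 hx2 hx3 hx4
  change (W a (W b φ) : ℝ → ℂ) x =
    (Complex.exp (Complex.I * (a.1 * b.2 - a.2 * b.1) / 2) • W (a + b) φ : Lp ℂ 2 volume) x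
  rw [hx1, hx3, hx4, Pi.smul_apply, hx2, smul_eq_mul, add_assoc x a.1 b.1]
  simp only [← mul_assoc, ← Complex.exp_add, Prod.fst_add, Prod.snd_add, Complex.ofReal_add]
  congr 2
  ring

theorem inner_map_map (hW : IsWeylSystem W) (a : ℝ × ℝ) (φ χ : Lp ℂ 2 (volume : Measure ℝ)) :
    inner ℂ (W a φ) (W a χ) = inner ℂ φ χ := by
  rw [L2.inner_def, L2.inner_def,
    ← integral_add_right_eq_self (fun x => inner ℂ ((φ : ℝ → ℂ) x) ((χ : ℝ → ℂ) x)) a.1]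
  refine integral_congr_ae ?_
  filter_upwards [hW a φ, hW a χ] with x hx1 hx2
  rw [hx1, hx2]
  have h : ∀ t : ℝ, (starRingEnd ℂ) (Complex.exp (Complex.I * t)) *
      Complex.exp (Complex.I * t) = 1 := by
    intro t
    rw [← Complex.exp_conj, ← Complex.exp_add]
    simp
  have h1 := h (a.1 * a.2 / 2)
  have h2 := h (a.2 * x)
  push_cast at h1 h2
  simp only [mul_div_assoc] at h1 h2
  simp only [RCLike.inner_apply, map_mul, mul_div_assoc, mul_assoc]
  set u := Complex.exp (Complex.I * (a.1 * (a.2 / 2)))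
  set v := Complex.exp (Complex.I * (a.2 * x))
  linear_combination (χ : ℝ → ℂ) (x + a.1) * (starRingEnd ℂ) ((φ : ℝ → ℂ) (x + a.1)) *
    ((starRingEnd ℂ) v * v * h1 + h2)

theorem star_mul_self (hW : IsWeylSystem W) (a : ℝ × ℝ) : star (W a) * W a = 1 := by
  ext1 φ
  refine ext_inner_left ℂ fun χ => ?_
  change inner ℂ χ (star (W a) (W a φ)) = inner ℂ χ φ
  rw [inner_apply_star, hW.inner_map_map]

theorem star_eq (hW : IsWeylSystem W) (a : ℝ × ℝ) : star (W a) = W (-a) := by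
  have h : W a * W (-a) = 1 := by
    rw [hW.mul, add_neg_cancel, hW.zero]
    simp [mul_comm]
  calc star (W a) = star (W a) * (W a * W (-a)) := by rw [h, mul_one]
    _ = W (-a) := by rw [← mul_assoc, hW.star_mul_self, one_mul]

theorem comm_of_symplectic (hW : IsWeylSystem W) {a b : ℝ × ℝ} {n : ℤ}
    (h : a.1 * b.2 - a.2 * b.1 = 2 * π * n) :
    W a * W b = W b * W a := by
  rw [hW.mul, hW.mul, add_comm b a]
  congr 1
  rw [Complex.exp_eq_exp_iff_exists_int]
  refine ⟨n, ?_⟩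
  have h' : (a.1 * b.2 - a.2 * b.1 : ℂ) = 2 * π * n := by exact_mod_cast h
  linear_combination Complex.I * h'

theorem inner_indicator_eq_zero (hW : IsWeylSystem W) {δ : ℝ} {a : ℝ × ℝ} (ha : δ ≤ |a.1|) :
    inner ℂ (indicatorConstLp 2 (measurableSet_Ioo (a := (0 : ℝ)) (b := δ))
        (measure_Ioo_lt_top (μ := volume)).ne (1 : ℂ))
      (W a (indicatorConstLp 2 (measurableSet_Ioo (a := (0 : ℝ)) (b := δ))
        (measure_Ioo_lt_top (μ := volume)).ne (1 : ℂ))) = 0 := by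
  set φ := indicatorConstLp 2 (measurableSet_Ioo (a := (0 : ℝ)) (b := δ))
        (measure_Ioo_lt_top (μ := volume)).ne (1 : ℂ) with hφ
  rw [L2.inner_def]
  refine integral_eq_zero_of_ae ?_
  have h0 : ∀ᵐ x : ℝ, x ∉ Set.Ioo 0 δ → (φ : ℝ → ℂ) x = 0 := indicatorConstLp_coeFn_notMem
  have h1 := (measurePreserving_add_right (volume : Measure ℝ) a.1).quasiMeasurePreserving.ae h0
  filter_upwards [h0, h1, hW a φ] with x hx hx1 hx2
  rw [hx2]
  by_cases h : x ∈ Set.Ioo 0 δ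
  · rw [hx1]
    · simp
    · rintro ⟨h2, h3⟩
      obtain ⟨h4, h5⟩ := h
      have : |a.1| < δ := abs_lt.2 ⟨by linarith, by linarith⟩
      linarith
  · rw [hx h]
    simp

/-- The star algebra generated by the Weyl operators of an additive subgroup is their span. -/
theorem adjoin_le_span (hW : IsWeylSystem W) (L : AddSubgroup (ℝ × ℝ))
    {T : Lp ℂ 2 (volume : Measure ℝ) →L[ℂ] Lp ℂ 2 (volume : Measure ℝ)}
    (hT : T ∈ StarAlgebra.adjoin ℂ (W '' L)) : T ∈ Submodule.span ℂ (W '' L) := by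
  induction hT using StarAlgebra.adjoin_induction with
  | mem x hx => exact Submodule.subset_span hx
  | algebraMap r =>
    rw [Algebra.algebraMap_eq_smul_one, ← hW.zero]
    exact Submodule.smul_mem _ _ (Submodule.subset_span ⟨0, L.zero_mem, rfl⟩)
  | add x y _ _ hx hy => exact add_mem hx hy
  | mul x y _ _ hx hy =>
    refine (Submodule.span_mul_span ℂ (W '' L) (W '' L)).le.trans ?_
      (Submodule.mul_mem_mul hx hy)
    refine Submodule.span_le.2 ?_
    rintro _ ⟨_, ⟨a, ha, rfl⟩, _, ⟨b, hb, rfl⟩, rfl⟩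
    simp only [hW.mul]
    exact Submodule.smul_mem _ _ (Submodule.subset_span ⟨a + b, L.add_mem ha hb, rfl⟩)
  | star x h hx =>
    clear h
    induction hx using Submodule.span_induction with
    | mem x hx =>
      obtain ⟨a, ha, rfl⟩ := hx
      rw [hW.star_eq]
      exact Submodule.subset_span ⟨-a, L.neg_mem ha, rfl⟩
    | zero => simp
    | add x y _ _ hx hy => rw [star_add]; exact add_mem hx hy
    | smul c x _ hx => rw [star_smul]; exact Submodule.smul_mem _ _ hx

end IsWeylSystem

theorem exists_pos_le_abs_add_of_irrational {s x : ℝ} (hs : 0 < s)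
    (hx : Irrational (x / s)) (n : ℕ) :
    ∃ δ > 0, ∀ d : ℤ, d ≠ 0 → |d| ≤ n → ∀ m : ℤ, δ ≤ |s * m + x * d| := by
  have h : ∀ᶠ δ in nhdsWithin (0 : ℝ) (Set.Ioi 0), ∀ d ∈ Finset.Icc (-n : ℤ) n, d ≠ 0 →
      ∀ m : ℤ, δ ≤ |s * m + x * d| := by
    rw [Filter.eventually_all_finset]
    intro d _
    by_cases hd : d = 0
    · simp [hd]
    set y := x / s * d with hy
    have hyi : Irrational y := hx.mul_intCast hd
    have hpos : 0 < s * |y - round y| :=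
      mul_pos hs (abs_pos.2 (sub_ne_zero.2 (hyi.ne_int _)))
    filter_upwards [Ioo_mem_nhdsGT hpos] with δ hδ _ m
    have h1 := round_le y (-m)
    calc δ ≤ s * |y - round y| := hδ.2.le
      _ ≤ s * |y - (-m : ℤ)| := by gcongr
      _ = |s * m + x * d| := by
        rw [← abs_of_pos hs, ← abs_mul, abs_of_pos hs, hy]
        congr 1
        push_cast
        field_simp
        ring
  obtain ⟨δ, h1, h2⟩ := (h.and self_mem_nhdsWithin).exists
  exact ⟨δ, h2, fun d hd hdn => h1 d (Finset.mem_Icc.2 (abs_le.1 hdn)) hd⟩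

theorem indicatorConstLp_Ioo_ne_zero {δ : ℝ} (hδ : 0 < δ) :
    indicatorConstLp 2 (measurableSet_Ioo (a := (0 : ℝ)) (b := δ))
      (measure_Ioo_lt_top (μ := volume)).ne (1 : ℂ) ≠ 0 := by
  rw [← norm_ne_zero_iff, norm_indicatorConstLp (by simp) (by simp)]
  simp only [norm_one, one_mul]
  refine (rpow_pos_of_pos ?_ _).ne'
  simpa [measureReal_def, ENNReal.toReal_ofReal hδ.le] using hδ

end Weyl

theorem topologicalClosure_span_pow_ne_top (θ : ℝ) (hθ : 0 < θ)
    (hirr : Irrational (θ / (2 * π)))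
    (W : ℝ × ℝ → Lp ℂ 2 (volume : Measure ℝ) →L[ℂ] Lp ℂ 2 (volume : Measure ℝ))
    (hW : IsWeylSystem W)
    (H : Lp ℂ 2 (volume : Measure ℝ) →L[ℂ] Lp ℂ 2 (volume : Measure ℝ))
    (hsa : IsSelfAdjoint H)
    (hmem : H ∈ (StarAlgebra.adjoin ℂ (Set.range fun m : ℤ × ℤ =>
        W (Real.sqrt θ * (m.1 : ℝ), Real.sqrt θ * (m.2 : ℝ)))).topologicalClosure)
    (k : ℕ) (ψ : Fin k → Lp ℂ 2 (volume : Measure ℝ)) :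
    (Submodule.span ℂ
      {v | ∃ (n : ℕ) (j : Fin k), v = (H ^ n) (ψ j)}).topologicalClosure ≠ ⊤ := by
  intro htop
  set s := Real.sqrt θ with hs
  have hs0 : 0 < s := Real.sqrt_pos.2 hθ
  have hss : s * s = θ := Real.mul_self_sqrt hθ.le
  let L : AddSubgroup (ℝ × ℝ) := AddMonoidHom.range
    ((((AddMonoidHom.mulLeft s).comp (Int.castAddHom ℝ)).prodMap
      ((AddMonoidHom.mulLeft s).comp (Int.castAddHom ℝ))))
  have hL : (Set.range fun m : ℤ × ℤ => W (s * (m.1 : ℝ), s * (m.2 : ℝ))) = W '' L := by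
    ext T
    constructor
    · rintro ⟨m, rfl⟩
      exact ⟨_, ⟨m, rfl⟩, rfl⟩
    · rintro ⟨_, ⟨m, rfl⟩, rfl⟩
      exact ⟨m, rfl⟩
  rw [hL] at hmem
  set 𝒲 := StarAlgebra.adjoin ℂ (W '' L) with h𝒲
  set 𝒜 := StarAlgebra.adjoin ℂ {H} with h𝒜
  have hle : 𝒜 ≤ 𝒲.topologicalClosure := StarAlgebra.adjoin_le (Set.singleton_subset_iff.2 hmem)
  have hcomm : ∀ a ∈ 𝒜, ∀ b ∈ 𝒜, a * b = b * a := by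
    have := hsa.isStarNormal
    intro a ha b hb
    exact congrArg Subtype.val (mul_comm (⟨a, ha⟩ : 𝒜) ⟨b, hb⟩)
  set t := 2 * π / s with ht
  have hirr' : Irrational (t / s) := by
    have : t / s = (θ / (2 * π))⁻¹ := by rw [ht, inv_div, ← hss]; field_simp
    rw [this]
    exact hirr.inv
  let V : Fin (k + 1) → Lp ℂ 2 (volume : Measure ℝ) →L[ℂ] Lp ℂ 2 (volume : Measure ℝ) :=
    fun p => W (t * (p : ℕ), 0)
  have hst : s * t = 2 * π := by rw [ht]; field_simp
  have hVL : ∀ (p : ℤ), ∀ b ∈ L, W (t * p, 0) * W b = W b * W (t * p, 0) := by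
    rintro p _ ⟨m, rfl⟩
    refine hW.comm_of_symplectic (n := p * m.2) ?_
    change t * p * (s * m.2) - 0 * (s * m.1) = 2 * π * ((p * m.2 : ℤ) : ℝ)
    push_cast
    linear_combination (p * m.2 : ℝ) * hst
  have hV : ∀ p, V p ∈ commutant 𝒜 := by
    intro p
    have h1 : 𝒲.topologicalClosure ≤ StarSubalgebra.centralizer ℂ {V p} := by
      refine StarSubalgebra.topologicalClosure_minimal (StarAlgebra.adjoin_le ?_)
        (Set.isClosed_centralizer _)
      rintro _ ⟨b, hb, rfl⟩
      rw [SetLike.mem_coe, StarSubalgebra.mem_centralizer_iff]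
      rintro _ rfl
      refine ⟨by simpa using hVL p b hb, ?_⟩
      rw [hW.star_eq]
      simpa using hVL (-p) b hb
    refine mem_commutant_iff.2 fun a ha => ?_
    exact ((StarSubalgebra.mem_centralizer_iff ℂ).1 (h1 (hle ha)) _ rfl).1.symm
  obtain ⟨δ, hδ, hsep⟩ := exists_pos_le_abs_add_of_irrational hs0 hirr' (k + 1)
  have horth : ∀ p q : Fin (k + 1), p ≠ q → ∀ a ∈ 𝒜, inner ℂ
      (V p (indicatorConstLp 2 (measurableSet_Ioo (a := (0 : ℝ)) (b := δ))
        (measure_Ioo_lt_top (μ := volume)).ne (1 : ℂ)))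
      (a (V q (indicatorConstLp 2 (measurableSet_Ioo (a := (0 : ℝ)) (b := δ))
        (measure_Ioo_lt_top (μ := volume)).ne (1 : ℂ)))) = 0 := by
    intro p q hpq a ha
    set φ := indicatorConstLp 2 (measurableSet_Ioo (a := (0 : ℝ)) (b := δ))
        (measure_Ioo_lt_top (μ := volume)).ne (1 : ℂ) with hφ
    have hcl : IsClosed {T : Lp ℂ 2 (volume : Measure ℝ) →L[ℂ] Lp ℂ 2 (volume : Measure ℝ) |
        inner ℂ (V p φ) (T (V q φ)) = 0} :=
      isClosed_singleton.preimage (by fun_prop :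
        Continuous fun T : Lp ℂ 2 (volume : Measure ℝ) →L[ℂ] Lp ℂ 2 (volume : Measure ℝ) =>
          inner ℂ (V p φ) (T (V q φ)))
    refine closure_minimal ?_ hcl (hle ha)
    intro T hT
    change inner ℂ (V p φ) (T (V q φ)) = 0
    have hT' := hW.adjoin_le_span L hT
    clear hT
    induction hT' using Submodule.span_induction with
    | mem x hx =>
      obtain ⟨b, ⟨m, hm⟩, rfl⟩ := hx
      rw [← inner_apply_star, hW.star_eq]
      change inner ℂ φ ((W (-(t * (p : ℕ), 0)) * (W b * W (t * (q : ℕ), 0))) φ) = 0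
      rw [hW.mul, mul_smul_comm, hW.mul, smul_smul, smul_apply, inner_smul_right, hφ,
        hW.inner_indicator_eq_zero, mul_zero]
      have hb : b.1 = s * m.1 := by rw [← hm]; rfl
      have h1 := hsep ((q : ℕ) - (p : ℕ) : ℤ) (by omega) (by rw [abs_le]; omega) m.1
      convert h1 using 2
      simp only [Prod.fst_add, Prod.fst_neg, hb]
      push_cast
      ring
    | zero => simp
    | add x y _ _ hx hy => rw [add_apply, inner_add_right, hx, hy, add_zero]
    | smul c x _ hx => rw [smul_apply, inner_smul_right, hx, mul_zero]
  have hψ : ∀ T ∈ commutant 𝒜, (∀ j, T (ψ j) = 0) → T = 0 := by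
    intro T hT h
    have h1 : (Submodule.span ℂ
        {v | ∃ (n : ℕ) (j : Fin k), v = (H ^ n) (ψ j)}).topologicalClosure ≤
        T.toLinearMap.ker := by
      refine Submodule.topologicalClosure_minimal _ (Submodule.span_le.2 ?_) T.isClosed_ker
      rintro _ ⟨n, j, rfl⟩
      have h2 : H ^ n ∈ 𝒜 := pow_mem (StarAlgebra.self_mem_adjoin_singleton ℂ H) n
      change T ((H ^ n) (ψ j)) = 0
      rw [commutant_apply hT h2, h, map_zero]
    ext1 x
    exact h1 (htop ▸ Submodule.mem_top)
  have := card_le_of_separating hcomm (indicatorConstLp_Ioo_ne_zero hδ) V hV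
    (fun p => hW.star_mul_self _) horth ψ hψ
  omega

/-- **Proposition 2 of Bellissard–Schulz-Baldes (infinite multiplicity).**
Let `θ > 0` with `θ/2π` irrational and let `W : ℝ² → B(L²(ℝ))` be the Weyl system,
determined by `(W(a)ψ)(x) = e^{ia₁a₂/2} e^{ia₂x} ψ(x+a₁)`.  Let `H` be a self-adjoint
element of the C*-subalgebra of `B(L²(ℝ))` generated by `{W(√θ m) : m ∈ ℤ²}` (the Weyl
representation of the rotation algebra).  Then `H` has no cyclic vector, and moreover has
infinite multiplicity: for every finite family `ψ₁, …, ψ_k`, the closed span of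
`{Hⁿψⱼ : n ∈ ℕ, 1 ≤ j ≤ k}` is a proper subspace of `L²(ℝ)`. -/
theorem rotation_algebra_weyl_no_cyclic_vector (θ : ℝ) (hθ : 0 < θ)
    (hirr : Irrational (θ / (2 * π)))
    (W : ℝ × ℝ → Lp ℂ 2 (volume : Measure ℝ) →L[ℂ] Lp ℂ 2 (volume : Measure ℝ))
    (hW : ∀ (a : ℝ × ℝ) (φ : Lp ℂ 2 (volume : Measure ℝ)),
      (W a φ : ℝ → ℂ) =ᵐ[volume] fun x =>
        Complex.exp (Complex.I * a.1 * a.2 / 2) *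
          (Complex.exp (Complex.I * a.2 * x) * (φ : ℝ → ℂ) (x + a.1)))
    (H : Lp ℂ 2 (volume : Measure ℝ) →L[ℂ] Lp ℂ 2 (volume : Measure ℝ))
    (hsa : IsSelfAdjoint H)
    (hmem : H ∈ (StarAlgebra.adjoin ℂ (Set.range fun m : ℤ × ℤ =>
        W (Real.sqrt θ * (m.1 : ℝ), Real.sqrt θ * (m.2 : ℝ)))).topologicalClosure) :
    (∀ ψ : Lp ℂ 2 (volume : Measure ℝ),
      (Submodule.span ℂ (Set.range fun n : ℕ => (H ^ n) ψ)).topologicalClosure ≠ ⊤) ∧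
    (∀ (k : ℕ) (ψ : Fin k → Lp ℂ 2 (volume : Measure ℝ)),
      (Submodule.span ℂ
          {v | ∃ (n : ℕ) (j : Fin k), v = (H ^ n) (ψ j)}).topologicalClosure ≠ ⊤) := by
  have h := topologicalClosure_span_pow_ne_top θ hθ hirr W hW H hsa hmem
  refine ⟨fun ψ => ?_, h⟩
  have h1 := h 1 fun _ => ψ
  have h2 : {v | ∃ (n : ℕ) (_ : Fin 1), v = (H ^ n) ψ} = Set.range fun n : ℕ => (H ^ n) ψ := by
    ext v
    simp [eq_comm]
  rwa [h2] at h1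
end

section
/- Metaplectic implementation of SL(2,ℝ) generators on Weyl operators: (i) for κ∈ℝ, the unitary M_κ on L²(ℝ) of multiplication by e^{−iκx²/2} satisfies M_κ·𝔚(a₁,a₂)·M_κ* = 𝔚(a₁, κa₁+a₂) for all (a₁,a₂)∈ℝ²; (ii) for λ>0, the dilation unitary (D_λφ)(x)=λ^{−1/2}φ(x/λ) satisfies D_λ·𝔚(a₁,a₂)·D_λ* = 𝔚(λa₁, λ⁻¹a₂); (iii) for 0<s<π, the integral operator (F_s φ)(x) = ∫_ℝ (2π·sin s)^{−1/2} · e^{ i( cos s·(x²+y²) − 2xy )/(2 sin s) } φ(y) dy is unitary on L²(ℝ) and satisfies F_s·𝔚(a₁,a₂)·F_s* = 𝔚(cos s·a₁ − sin s·a₂, sin s·a₁ + cos s·a₂). -/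
open MeasureTheory Real

open ContinuousLinearMap in
/-- A surjective isometry that intertwines `A` and `B` conjugates `A` into `B`. -/
theorem comp_comp_adjoint_eq_of_intertwines {H : Type*} [NormedAddCommGroup H]
    [InnerProductSpace ℂ H] [CompleteSpace H] {U A B : H →L[ℂ] H}
    (hnorm : ∀ φ, ‖U φ‖ = ‖φ‖) (hsurj : Function.Surjective U) (h : ∀ φ, U (A φ) = B (U φ)) :
    U ∘L A ∘L adjoint U = B := by
  have hUU := (norm_map_iff_adjoint_comp_self U).1 hnorm
  ext1 ψ
  obtain ⟨φ, rfl⟩ := hsurj ψ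
  have : adjoint U (U φ) = φ := DFunLike.congr_fun hUU φ
  simp [this, h]

theorem hasTemperateGrowth_cexp_ofReal_mul_I :
    (fun x : ℝ => Complex.exp (x * Complex.I)).HasTemperateGrowth := by
  have hder (n : ℕ) : iteratedDeriv n (fun x : ℝ => Complex.exp (x * Complex.I)) =
      fun x : ℝ => Complex.I ^ n * Complex.exp (x * Complex.I) := by
    induction n with
    | zero => simp
    | succ n ih =>
      rw [iteratedDeriv_succ, ih]
      funext x
      have h : HasDerivAt (fun x : ℝ => Complex.exp (x * Complex.I))
          (Complex.exp (x * Complex.I) * (1 * Complex.I)) x :=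
        ((Complex.ofRealCLM.hasDerivAt (x := x)).mul_const Complex.I).cexp
      rw [(h.const_mul (Complex.I ^ n)).deriv]
      ring
  refine ⟨(Complex.ofRealCLM.contDiff.mul contDiff_const).cexp, fun n => ⟨0, 1, fun x => ?_⟩⟩
  rw [norm_iteratedFDeriv_eq_norm_iteratedDeriv, hder]
  simp [Complex.norm_exp_ofReal_mul_I]

theorem Function.HasTemperateGrowth.cexp_mul_I {f : ℝ → ℝ} (hf : f.HasTemperateGrowth) :
    (fun x => Complex.exp (f x * Complex.I)).HasTemperateGrowth :=
  hasTemperateGrowth_cexp_ofReal_mul_I.comp hf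

/-- The unitary dilation `x ↦ l^{-1/2} f (x / l)` preserves the `L²` seminorm. -/
theorem eLpNorm_two_inv_sqrt_mul_comp_div {l : ℝ} (hl : 0 < l) {f : ℝ → ℂ}
    (hf : AEStronglyMeasurable f volume) :
    eLpNorm (fun x => (((√l)⁻¹ : ℝ) : ℂ) * f (x / l)) 2 volume = eLpNorm f 2 volume := by
  have hmap : Measure.map (fun x : ℝ => x / l) volume = ENNReal.ofReal l • volume := by
    have := Real.map_volume_mul_right (inv_ne_zero hl.ne')
    simpa [div_eq_mul_inv, abs_of_pos hl] using this
  have hcomp : eLpNorm (fun x => f (x / l)) 2 volume =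
      ENNReal.ofReal (√l) * eLpNorm f 2 volume := by
    have := eLpNorm_map_measure (μ := volume) (p := 2) (f := fun x : ℝ => x / l) (g := f)
      (by rw [hmap]; exact hf.smul_measure _) (by fun_prop)
    rw [Function.comp_def] at this
    rw [← this, hmap, eLpNorm_smul_measure_of_ne_top (by simp), smul_eq_mul, Real.sqrt_eq_rpow,
      ENNReal.ofReal_rpow_of_pos hl]
    simp
  have hsqrt := Real.sqrt_pos.2 hl
  change eLpNorm ((((√l)⁻¹ : ℝ) : ℂ) • fun x => f (x / l)) 2 volume = _
  rw [eLpNorm_const_smul, hcomp, ← mul_assoc, ← ofReal_norm,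
    Complex.norm_of_nonneg (by positivity), ← ENNReal.ofReal_mul (by positivity),
    inv_mul_cancel₀ hsqrt.ne', ENNReal.ofReal_one, one_mul]

theorem Filter.EventuallyEq.comp_add_right {f g : ℝ → ℂ} (h : f =ᵐ[volume] g) (a : ℝ) :
    (fun x => f (x + a)) =ᵐ[volume] fun x => g (x + a) :=
  (measurePreserving_add_right volume a).quasiMeasurePreserving.ae_eq_comp h

theorem quasiMeasurePreserving_mul_right {a : ℝ} (ha : a ≠ 0) :
    Measure.QuasiMeasurePreserving (fun x : ℝ => x * a) volume volume := by
  refine ⟨by fun_prop, ?_⟩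
  rw [Real.map_volume_mul_right ha]
  exact Measure.smul_absolutelyContinuous

theorem Filter.EventuallyEq.comp_mul_right {f g : ℝ → ℂ} (h : f =ᵐ[volume] g) {a : ℝ}
    (ha : a ≠ 0) : (fun x => f (x * a)) =ᵐ[volume] fun x => g (x * a) :=
  (quasiMeasurePreserving_mul_right ha).ae_eq_comp h

/-- The Schwartz function `x ↦ e^{i(p x² + q x)} g x`. -/
noncomputable def SchwartzMap.chirp (p q : ℝ) (g : SchwartzMap ℝ ℂ) : SchwartzMap ℝ ℂ :=
  SchwartzMap.smulLeftCLM ℂ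
    (fun x : ℝ => Complex.exp ((p * x ^ 2 + q * x : ℝ) * Complex.I)) g

theorem SchwartzMap.chirp_apply (p q : ℝ) (g : SchwartzMap ℝ ℂ) (x : ℝ) :
    g.chirp p q x = Complex.exp ((p * x ^ 2 + q * x : ℝ) * Complex.I) * g x := by
  have h : (fun x : ℝ => p * x ^ 2 + q * x).HasTemperateGrowth :=
    ((Function.HasTemperateGrowth.const p).mul (Function.HasTemperateGrowth.id'.pow 2)).add
      ((Function.HasTemperateGrowth.const q).mul Function.HasTemperateGrowth.id')
  exact SchwartzMap.smulLeftCLM_apply_apply h.cexp_mul_I g x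

theorem SchwartzMap.norm_chirp_apply (p q : ℝ) (g : SchwartzMap ℝ ℂ) (x : ℝ) :
    ‖g.chirp p q x‖ = ‖g x‖ := by
  rw [chirp_apply, norm_mul, Complex.norm_exp_ofReal_mul_I, one_mul]

/-- The kernel operator of a rotation, as chirp, dilated Fourier transform, chirp. -/
theorem integral_rotation_kernel_eq {c σ : ℝ} (hσ : 0 < σ) (g : SchwartzMap ℝ ℂ) (x : ℝ) :
    (∫ y : ℝ, (((√(2 * π * σ))⁻¹ : ℝ) : ℂ) *
      (Complex.exp (Complex.I * ((c : ℂ) * ((x : ℂ) ^ 2 + (y : ℂ) ^ 2) - 2 * (x : ℂ) * (y : ℂ)) /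
        (2 * (σ : ℂ))) * g y)) =
    Complex.exp ((c / (2 * σ) * x ^ 2 : ℝ) * Complex.I) *
      ((((√(2 * π * σ))⁻¹ : ℝ) : ℂ) *
        FourierTransform.fourier (g.chirp (c / (2 * σ)) 0) (x / (2 * π * σ))) := by
  rw [SchwartzMap.fourier_coe, Real.fourier_real_eq_integral_exp_smul, ← integral_const_mul,
    ← integral_const_mul]
  refine integral_congr_ae (.of_forall fun y => ?_)
  simp only [SchwartzMap.chirp_apply, smul_eq_mul]
  have hexp : Complex.exp (Complex.I *
      ((c : ℂ) * ((x : ℂ) ^ 2 + (y : ℂ) ^ 2) - 2 * (x : ℂ) * (y : ℂ)) / (2 * (σ : ℂ))) =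
      Complex.exp ((c / (2 * σ) * x ^ 2 : ℝ) * Complex.I) *
      (Complex.exp ((-2 * π * y * (x / (2 * π * σ)) : ℝ) * Complex.I) *
      Complex.exp ((c / (2 * σ) * y ^ 2 + 0 * y : ℝ) * Complex.I)) := by
    have hσ' : (σ : ℂ) ≠ 0 := by exact_mod_cast hσ.ne'
    have hπ : (π : ℂ) ≠ 0 := by exact_mod_cast pi_ne_zero
    rw [← Complex.exp_add, ← Complex.exp_add]
    congr 1
    push_cast
    field_simp
    ring
  rw [hexp]
  ring

/-- The Weyl relation at the level of the kernel of a rotation. -/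
theorem integral_rotation_kernel_weyl {c σ : ℝ} (hσ : σ ≠ 0) (hc : c ^ 2 + σ ^ 2 = 1) (C : ℂ)
    (g : ℝ → ℂ) (a : ℝ × ℝ) (x : ℝ) :
    (∫ y : ℝ, C *
      (Complex.exp (Complex.I * ((c : ℂ) * ((x : ℂ) ^ 2 + (y : ℂ) ^ 2) - 2 * (x : ℂ) * (y : ℂ)) /
        (2 * (σ : ℂ))) * (Complex.exp (Complex.I * a.1 * a.2 / 2) *
          (Complex.exp (Complex.I * a.2 * y) * g (y + a.1))))) =
    Complex.exp (Complex.I * (c * a.1 - σ * a.2 : ℝ) * (σ * a.1 + c * a.2 : ℝ) / 2) *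
      (Complex.exp (Complex.I * (σ * a.1 + c * a.2 : ℝ) * x) *
        ∫ y : ℝ, C * (Complex.exp (Complex.I *
          ((c : ℂ) * (((x + (c * a.1 - σ * a.2) : ℝ) : ℂ) ^ 2 + (y : ℂ) ^ 2) -
            2 * ((x + (c * a.1 - σ * a.2) : ℝ) : ℂ) * (y : ℂ)) / (2 * (σ : ℂ))) * g y)) := by
  conv_rhs => rw [← integral_add_right_eq_self _ a.1]
  rw [← integral_const_mul, ← integral_const_mul]
  refine integral_congr_ae (.of_forall fun y => ?_)
  dsimp only
  set b₁ := c * a.1 - σ * a.2 with hb₁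
  set b₂ := σ * a.1 + c * a.2 with hb₂
  have hexp : Complex.exp (Complex.I *
        ((c : ℂ) * ((x : ℂ) ^ 2 + (y : ℂ) ^ 2) - 2 * (x : ℂ) * (y : ℂ)) / (2 * (σ : ℂ))) *
      (Complex.exp (Complex.I * a.1 * a.2 / 2) * Complex.exp (Complex.I * a.2 * y)) =
      Complex.exp (Complex.I * b₁ * b₂ / 2) * (Complex.exp (Complex.I * b₂ * x) *
      Complex.exp (Complex.I * ((c : ℂ) * (((x + b₁ : ℝ) : ℂ) ^ 2 + ((y + a.1 : ℝ) : ℂ) ^ 2) -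
        2 * ((x + b₁ : ℝ) : ℂ) * ((y + a.1 : ℝ) : ℂ)) / (2 * (σ : ℂ)))) := by
    have hσ' : (σ : ℂ) ≠ 0 := by exact_mod_cast hσ
    have hc' : (c : ℂ) ^ 2 + (σ : ℂ) ^ 2 = 1 := by exact_mod_cast hc
    simp only [← Complex.exp_add]
    congr 1
    rw [hb₁, hb₂]
    push_cast
    field_simp
    linear_combination (-(2 * x * a.1 + (c * a.1 - σ * a.2) * a.1) : ℂ) * hc'
  linear_combination C * g (y + a.1) * hexp


theorem rotation_kernel_toLp {c σ : ℝ} (hσ : 0 < σ)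
    {F : Lp ℂ 2 (volume : Measure ℝ) →L[ℂ] Lp ℂ 2 (volume : Measure ℝ)}
    (hF : ∀ (g : SchwartzMap ℝ ℂ) (gL : Lp ℂ 2 (volume : Measure ℝ)),
        (gL : ℝ → ℂ) =ᵐ[volume] g →
        (F gL : ℝ → ℂ) =ᵐ[volume] fun x => ∫ y : ℝ,
          (((√(2 * π * σ))⁻¹ : ℝ) : ℂ) *
            (Complex.exp (Complex.I *
                ((c : ℂ) * ((x : ℂ) ^ 2 + (y : ℂ) ^ 2) - 2 * (x : ℂ) * (y : ℂ)) /
                (2 * (σ : ℂ))) * g y)) (g : SchwartzMap ℝ ℂ) :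
    (F (g.toLp 2) : ℝ → ℂ) =ᵐ[volume] fun x =>
      Complex.exp ((c / (2 * σ) * x ^ 2 : ℝ) * Complex.I) *
      ((((√(2 * π * σ))⁻¹ : ℝ) : ℂ) *
        FourierTransform.fourier (g.chirp (c / (2 * σ)) 0) (x / (2 * π * σ))) := by
  filter_upwards [hF g _ (g.coeFn_toLp 2)] with x hx
  rw [hx, integral_rotation_kernel_eq hσ]

theorem norm_rotation_kernel {c σ : ℝ} (hσ : 0 < σ)
    {F : Lp ℂ 2 (volume : Measure ℝ) →L[ℂ] Lp ℂ 2 (volume : Measure ℝ)}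
    (hF : ∀ g : SchwartzMap ℝ ℂ, (F (g.toLp 2) : ℝ → ℂ) =ᵐ[volume] fun x =>
      Complex.exp ((c / (2 * σ) * x ^ 2 : ℝ) * Complex.I) *
      ((((√(2 * π * σ))⁻¹ : ℝ) : ℂ) *
        FourierTransform.fourier (g.chirp (c / (2 * σ)) 0) (x / (2 * π * σ))))
    (φ : Lp ℂ 2 (volume : Measure ℝ)) : ‖F φ‖ = ‖φ‖ := by
  have key (g : SchwartzMap ℝ ℂ) : ‖F (g.toLp 2)‖ = ‖g.toLp 2‖ := by
    have hg := hF g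
    have hchirp := g.norm_chirp_apply (c / (2 * σ)) 0
    generalize g.chirp (c / (2 * σ)) 0 = G at hg hchirp
    have h₁ : ‖F (g.toLp 2)‖ = ‖(FourierTransform.fourier G).toLp 2‖ := by
      rw [Lp.norm_def, eLpNorm_congr_ae hg, SchwartzMap.norm_toLp,
        ← eLpNorm_two_inv_sqrt_mul_comp_div (l := 2 * π * σ) (by positivity)
        (FourierTransform.fourier G).continuous.aestronglyMeasurable]
      congr 1
      refine eLpNorm_congr_norm_ae (.of_forall fun x => ?_)
      rw [norm_mul, Complex.norm_exp_ofReal_mul_I, one_mul]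
    have h₂ : ‖G.toLp 2‖ = ‖g.toLp 2‖ := by
      rw [SchwartzMap.norm_toLp, SchwartzMap.norm_toLp]
      congr 1
      exact eLpNorm_congr_norm_ae (.of_forall hchirp)
    rw [h₁, SchwartzMap.norm_fourier_toL2_eq, h₂]
  exact (SchwartzMap.denseRange_toLpCLM (E := ℝ) (F := ℂ) (p := 2) (μ := volume)
    (by simp)).induction_on (p := fun φ => ‖F φ‖ = ‖φ‖) φ
    (isClosed_eq (by fun_prop) (by fun_prop)) key

theorem surjective_rotation_kernel {c σ : ℝ} (hσ : 0 < σ)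
    {F : Lp ℂ 2 (volume : Measure ℝ) →L[ℂ] Lp ℂ 2 (volume : Measure ℝ)}
    (hF : ∀ g : SchwartzMap ℝ ℂ, (F (g.toLp 2) : ℝ → ℂ) =ᵐ[volume] fun x =>
      Complex.exp ((c / (2 * σ) * x ^ 2 : ℝ) * Complex.I) *
      ((((√(2 * π * σ))⁻¹ : ℝ) : ℂ) *
        FourierTransform.fourier (g.chirp (c / (2 * σ)) 0) (x / (2 * π * σ)))) :
    Function.Surjective F := by
  have hl : 0 < 2 * π * σ := by positivity
  have hiso : Isometry F := AddMonoidHomClass.isometry_of_norm F (norm_rotation_kernel hσ hF)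
  refine Set.range_eq_univ.1 (hiso.isClosedEmbedding.isClosed_range.closure_eq.symm.trans ?_)
  refine Dense.closure_eq (Dense.mono ?_ (SchwartzMap.denseRange_toLpCLM (E := ℝ) (F := ℂ)
    (p := 2) (μ := volume) (by simp)))
  rintro _ ⟨h, rfl⟩
  let K : SchwartzMap ℝ ℂ := ((√(2 * π * σ) : ℝ) : ℂ) •
    SchwartzMap.compCLMOfContinuousLinearEquiv ℂ
      (ContinuousLinearEquiv.unitsEquivAut ℝ (Units.mk0 (2 * π * σ) hl.ne'))
      (h.chirp (-(c / (2 * σ))) 0)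
  let g := (FourierTransformInv.fourierInv K).chirp (-(c / (2 * σ))) 0
  have hg : g.chirp (c / (2 * σ)) 0 = FourierTransformInv.fourierInv K := by
    ext x
    rw [SchwartzMap.chirp_apply, SchwartzMap.chirp_apply, ← mul_assoc, ← Complex.exp_add]
    simp
  refine ⟨g.toLp 2, Lp.ext ?_⟩
  filter_upwards [hF g, h.coeFn_toLp 2] with x hx hx'
  rw [hx, SchwartzMap.toLpCLM_apply, hx', hg, FourierTransform.fourier_fourierInv_eq]
  have hK : K (x / (2 * π * σ)) = ((√(2 * π * σ) : ℝ) : ℂ) *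
      (Complex.exp ((-(c / (2 * σ)) * x ^ 2 + 0 * x : ℝ) * Complex.I) * h x) := by
    simp only [K, smul_apply, smul_eq_mul,
      SchwartzMap.compCLMOfContinuousLinearEquiv_apply, Function.comp_apply,
      ContinuousLinearEquiv.unitsEquivAut_apply, Units.val_mk0, div_mul_cancel₀ _ hl.ne',
      SchwartzMap.chirp_apply]
  have hs : ((√(2 * π * σ) : ℝ) : ℂ) ≠ 0 := by exact_mod_cast (Real.sqrt_pos.2 hl).ne'
  rw [hK, Complex.ofReal_inv, inv_mul_cancel_left₀ hs, ← mul_assoc, ← Complex.exp_add]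
  simp

/-- **Metaplectic implementation of the `SL(2,ℝ)` generators on Weyl operators
(Proposition 8 of Bellissard–Schulz-Baldes).**  Let `W : ℝ² → B(L²(ℝ))` be the Weyl system,
determined by `(W(a)ψ)(x) = e^{ia₁a₂/2} e^{ia₂x} ψ(x+a₁)`.  Then:
(i) for `κ ∈ ℝ`, the operator `M_κ` of multiplication by `e^{−iκx²/2}` satisfies
`M_κ W(a₁,a₂) M_κ* = W(a₁, κa₁+a₂)`;
(ii) for `λ > 0`, the dilation `(D_λφ)(x) = λ^{−1/2} φ(x/λ)` satisfies
`D_λ W(a₁,a₂) D_λ* = W(λa₁, λ⁻¹a₂)`;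
(iii) for `0 < s < π`, the integral operator
`(F_s φ)(x) = ∫ (2π sin s)^{−1/2} e^{i(cos s·(x²+y²) − 2xy)/(2 sin s)} φ(y) dy`
(determined by this formula on Schwartz functions) is unitary on `L²(ℝ)` and satisfies
`F_s W(a₁,a₂) F_s* = W(cos s·a₁ − sin s·a₂, sin s·a₁ + cos s·a₂)`. -/
theorem metaplectic_implementation
    (W : ℝ × ℝ → Lp ℂ 2 (volume : Measure ℝ) →L[ℂ] Lp ℂ 2 (volume : Measure ℝ))
    (hW : ∀ (a : ℝ × ℝ) (φ : Lp ℂ 2 (volume : Measure ℝ)),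
      (W a φ : ℝ → ℂ) =ᵐ[volume] fun x =>
        Complex.exp (Complex.I * a.1 * a.2 / 2) *
          (Complex.exp (Complex.I * a.2 * x) * (φ : ℝ → ℂ) (x + a.1))) :
    (∀ (κ : ℝ) (M : Lp ℂ 2 (volume : Measure ℝ) →L[ℂ] Lp ℂ 2 (volume : Measure ℝ)),
      (∀ φ : Lp ℂ 2 (volume : Measure ℝ), (M φ : ℝ → ℂ) =ᵐ[volume] fun x =>
          Complex.exp (-Complex.I * κ * (x : ℂ) ^ 2 / 2) * (φ : ℝ → ℂ) x) →
      ∀ a : ℝ × ℝ,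
        M ∘L W a ∘L ContinuousLinearMap.adjoint M = W (a.1, κ * a.1 + a.2)) ∧
    (∀ (l : ℝ), 0 < l →
      ∀ D : Lp ℂ 2 (volume : Measure ℝ) →L[ℂ] Lp ℂ 2 (volume : Measure ℝ),
      (∀ φ : Lp ℂ 2 (volume : Measure ℝ), (D φ : ℝ → ℂ) =ᵐ[volume] fun x =>
          (((Real.sqrt l)⁻¹ : ℝ) : ℂ) * (φ : ℝ → ℂ) (x / l)) →
      ∀ a : ℝ × ℝ,
        D ∘L W a ∘L ContinuousLinearMap.adjoint D = W (l * a.1, l⁻¹ * a.2)) ∧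
    (∀ (s : ℝ), 0 < s → s < π →
      ∀ F : Lp ℂ 2 (volume : Measure ℝ) →L[ℂ] Lp ℂ 2 (volume : Measure ℝ),
      (∀ (g : SchwartzMap ℝ ℂ) (gL : Lp ℂ 2 (volume : Measure ℝ)),
        (gL : ℝ → ℂ) =ᵐ[volume] g →
        (F gL : ℝ → ℂ) =ᵐ[volume] fun x => ∫ y : ℝ,
          (((Real.sqrt (2 * π * Real.sin s))⁻¹ : ℝ) : ℂ) *
            (Complex.exp (Complex.I *
                ((Real.cos s : ℂ) * ((x : ℂ) ^ 2 + (y : ℂ) ^ 2) - 2 * (x : ℂ) * (y : ℂ)) /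
                (2 * (Real.sin s : ℂ))) * g y)) →
      (∀ φ : Lp ℂ 2 (volume : Measure ℝ), ‖F φ‖ = ‖φ‖) ∧
      Function.Surjective F ∧
      ∀ a : ℝ × ℝ,
        F ∘L W a ∘L ContinuousLinearMap.adjoint F =
          W (Real.cos s * a.1 - Real.sin s * a.2, Real.sin s * a.1 + Real.cos s * a.2)) := by
  refine ⟨fun κ M hM a => ?_, fun l hl D hD a => ?_, fun s hs hsπ F hF => ?_⟩
  · refine comp_comp_adjoint_eq_of_intertwines (fun φ => ?_) (fun ψ => ?_) fun φ => Lp.ext ?_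
    · rw [Lp.norm_def, Lp.norm_def, eLpNorm_congr_ae (hM φ)]
      congr 1
      refine eLpNorm_congr_norm_ae (.of_forall fun x => ?_)
      have : -Complex.I * κ * (x : ℂ) ^ 2 / 2 = ((-κ * x ^ 2 / 2 : ℝ) : ℂ) * Complex.I := by
        push_cast; ring
      rw [norm_mul, this, Complex.norm_exp_ofReal_mul_I, one_mul]
    · have hmem : MemLp (fun x : ℝ => Complex.exp ((κ * x ^ 2 / 2 : ℝ) * Complex.I) *
          (ψ : ℝ → ℂ) x) 2 volume := by
        refine (Lp.memLp ψ).congr_norm ?_ (.of_forall fun x => ?_)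
        · exact (Continuous.aestronglyMeasurable (by fun_prop)).mul (Lp.aestronglyMeasurable ψ)
        · rw [norm_mul, Complex.norm_exp_ofReal_mul_I, one_mul]
      refine ⟨hmem.toLp _, Lp.ext ?_⟩
      filter_upwards [hM (hmem.toLp _), hmem.coeFn_toLp] with x h₁ h₂
      rw [h₁, h₂, ← mul_assoc, ← Complex.exp_add]
      convert one_mul _
      rw [Complex.exp_eq_one_iff]
      exact ⟨0, by push_cast; ring⟩
    · filter_upwards [hM (W a φ), hW a φ, hW (a.1, κ * a.1 + a.2) (M φ),
        (hM φ).comp_add_right a.1] with x h₁ h₂ h₃ h₄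
      rw [h₁, h₂, h₃, h₄]
      simp only [← mul_assoc, ← Complex.exp_add]
      congr 2
      push_cast
      ring
  · have hl' : (l : ℂ) ≠ 0 := by exact_mod_cast hl.ne'
    have hdiv {f g : ℝ → ℂ} (h : f =ᵐ[volume] g) :
        (fun x => f (x / l)) =ᵐ[volume] fun x => g (x / l) := by
      simpa only [div_eq_mul_inv] using h.comp_mul_right (inv_ne_zero hl.ne')
    refine comp_comp_adjoint_eq_of_intertwines (fun φ => ?_) (fun ψ => ?_) fun φ => Lp.ext ?_
    · rw [Lp.norm_def, Lp.norm_def, eLpNorm_congr_ae (hD φ),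
        eLpNorm_two_inv_sqrt_mul_comp_div hl (Lp.aestronglyMeasurable φ)]
    · have hmem : MemLp (fun x : ℝ => (((√l⁻¹)⁻¹ : ℝ) : ℂ) * (ψ : ℝ → ℂ) (x / l⁻¹)) 2
          volume := by
        refine ⟨?_, ?_⟩
        · refine AEStronglyMeasurable.const_mul ?_ _
          simp only [div_inv_eq_mul]
          exact (Lp.aestronglyMeasurable ψ).comp_quasiMeasurePreserving
            (quasiMeasurePreserving_mul_right hl.ne')
        · rw [eLpNorm_two_inv_sqrt_mul_comp_div (inv_pos.2 hl) (Lp.aestronglyMeasurable ψ)]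
          exact Lp.eLpNorm_lt_top ψ
      refine ⟨hmem.toLp _, Lp.ext ?_⟩
      filter_upwards [hD (hmem.toLp _), hdiv hmem.coeFn_toLp] with x h₁ h₂
      have hs : ((√l : ℝ) : ℂ) ≠ 0 := by exact_mod_cast (Real.sqrt_pos.2 hl).ne'
      rw [h₁, h₂, div_inv_eq_mul, div_mul_cancel₀ _ hl.ne', Real.sqrt_inv, inv_inv,
        Complex.ofReal_inv, inv_mul_cancel_left₀ hs]
    · filter_upwards [hD (W a φ), hdiv (hW a φ), hW (l * a.1, l⁻¹ * a.2) (D φ),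
        (hD φ).comp_add_right (l * a.1)] with x h₁ h₂ h₃ h₄
      have hx : (x + l * a.1) / l = x / l + a.1 := by field_simp
      have e₁ : Complex.I * ((l * a.1 : ℝ) : ℂ) * ((l⁻¹ * a.2 : ℝ) : ℂ) / 2 =
          Complex.I * a.1 * a.2 / 2 := by
        push_cast; field_simp
      have e₂ : Complex.I * ((l⁻¹ * a.2 : ℝ) : ℂ) * x =
          Complex.I * a.2 * ((x / l : ℝ) : ℂ) := by
        push_cast; field_simp
      rw [h₁, h₂, h₃, h₄, hx, e₁, e₂]
      ring
  · have hσ := Real.sin_pos_of_pos_of_lt_pi hs hsπ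
    have hF' := rotation_kernel_toLp hσ hF
    have hnorm := norm_rotation_kernel hσ hF'
    have hsurj := surjective_rotation_kernel hσ hF'
    refine ⟨hnorm, hsurj, fun a => comp_comp_adjoint_eq_of_intertwines hnorm hsurj fun φ => ?_⟩
    have key (g : SchwartzMap ℝ ℂ) : F (W a (g.toLp 2)) =
        W (Real.cos s * a.1 - Real.sin s * a.2, Real.sin s * a.1 + Real.cos s * a.2)
          (F (g.toLp 2)) := by
      refine Lp.ext ?_
      let g' : SchwartzMap ℝ ℂ := Complex.exp (Complex.I * a.1 * a.2 / 2) •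
        (g.compSubConstCLM ℂ (-a.1)).chirp 0 a.2
      have hg' (x : ℝ) : g' x = Complex.exp (Complex.I * a.1 * a.2 / 2) *
          (Complex.exp (Complex.I * a.2 * x) * g (x + a.1)) := by
        have : Complex.I * a.2 * x = ((0 * x ^ 2 + a.2 * x : ℝ) : ℂ) * Complex.I := by
          push_cast; ring
        simp only [g', smul_apply, smul_eq_mul, SchwartzMap.chirp_apply,
          SchwartzMap.compSubConstCLM_apply, sub_neg_eq_add, this]
      have hWg : (W a (g.toLp 2) : ℝ → ℂ) =ᵐ[volume] g' := by
        filter_upwards [hW a (g.toLp 2), (g.coeFn_toLp 2).comp_add_right a.1] with x h₁ h₂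
        rw [h₁, h₂, hg']
      have hFg := Filter.EventuallyEq.comp_add_right (hF g (g.toLp 2) (g.coeFn_toLp 2))
        (Real.cos s * a.1 - Real.sin s * a.2)
      filter_upwards [hF g' _ hWg,
        hW (Real.cos s * a.1 - Real.sin s * a.2, Real.sin s * a.1 + Real.cos s * a.2)
          (F (g.toLp 2)), hFg] with x h₁ h₂ h₃
      rw [h₁, h₂, h₃]
      simp only [hg']
      exact integral_rotation_kernel_weyl hσ.ne' (Real.cos_sq_add_sin_sq s) _ g a x
    exact (SchwartzMap.denseRange_toLpCLM (E := ℝ) (F := ℂ) (p := 2) (μ := volume)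
      (by simp)).induction_on (p := fun φ => F (W a φ) = W _ (F φ)) φ
      (isClosed_eq (by fun_prop) (by fun_prop)) key
end

section
/- Let f be the entire function f(z) = Σ_{n∈ℤ} e^{−π n² − n z} (the series converges locally uniformly on ℂ). Then: (i) f(z+2πi)=f(z) and f(z+2π)=e^{z+π}·f(z) for all z∈ℂ; (ii) f has exactly one zero, counted with multiplicity, in the fundamental square {x+iy : 0≤x<2π, 0≤y<2π}, namely a simple zero at z=π+iπ. -/
open Real Complex

/-- The entire function `f(z) = Σ_{n∈ℤ} e^{−πn² − nz}` (a Jacobi theta function in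
disguise). -/
noncomputable def thetaLike (z : ℂ) : ℂ :=
  ∑' n : ℤ, Complex.exp (-(π : ℂ) * (n : ℂ) ^ 2 - (n : ℂ) * z)

theorem thetaLike_term_eq (n : ℤ) (z : ℂ) :
    Complex.exp (-(π : ℂ) * (n : ℂ) ^ 2 - (n : ℂ) * z) =
      jacobiTheta₂_term n (Complex.I * z / (2 * π)) Complex.I := by
  have hπ : (π : ℂ) ≠ 0 := Complex.ofReal_ne_zero.2 Real.pi_ne_zero
  rw [jacobiTheta₂_term]
  congr 1
  field_simp
  linear_combination (-(π : ℂ) * n ^ 2 - n * z) * Complex.I_sq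

theorem thetaLike_eq_jacobiTheta₂ (z : ℂ) :
    thetaLike z = jacobiTheta₂ (Complex.I * z / (2 * π)) Complex.I :=
  tsum_congr fun n => thetaLike_term_eq n z

theorem summable_thetaLike_term (z : ℂ) :
    Summable fun n : ℤ => Complex.exp (-(π : ℂ) * (n : ℂ) ^ 2 - (n : ℂ) * z) := by
  simp_rw [thetaLike_term_eq]
  exact (summable_jacobiTheta₂_term_iff _ _).2 (by simp)

theorem differentiable_thetaLike : Differentiable ℂ thetaLike := by
  rw [funext thetaLike_eq_jacobiTheta₂]
  intro z
  exact (differentiableAt_jacobiTheta₂_fst _ (by simp)).comp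
    (f := fun z : ℂ => Complex.I * z / (2 * π)) z (by fun_prop)

theorem thetaLike_add_two_pi_mul_I (z : ℂ) :
    thetaLike (z + 2 * (π : ℂ) * Complex.I) = thetaLike z := by
  have hπ : (π : ℂ) ≠ 0 := Complex.ofReal_ne_zero.2 Real.pi_ne_zero
  rw [thetaLike_eq_jacobiTheta₂, thetaLike_eq_jacobiTheta₂, ← jacobiTheta₂_add_left]
  congr 1
  field_simp
  linear_combination 2 * (π : ℂ) * Complex.I_sq

theorem thetaLike_add_two_pi (z : ℂ) :
    thetaLike (z + 2 * (π : ℂ)) = Complex.exp (z + (π : ℂ)) * thetaLike z := by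
  have hπ : (π : ℂ) ≠ 0 := Complex.ofReal_ne_zero.2 Real.pi_ne_zero
  have harg : Complex.I * (z + 2 * π) / (2 * π) = Complex.I * z / (2 * π) + Complex.I := by
    field_simp
  rw [thetaLike_eq_jacobiTheta₂, thetaLike_eq_jacobiTheta₂, harg, jacobiTheta₂_add_left']
  congr 2
  field_simp
  linear_combination -(z + (π : ℂ)) * Complex.I_sq

/-- Pairing the terms of index `m` and `-(m + 1)` of `thetaLike` around its zero `π + iπ`. -/
theorem thetaLike_term_add_reflected_term (m : ℕ) (u : ℂ) :
    Complex.exp (-(π : ℂ) * ((m : ℤ) : ℂ) ^ 2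
        - ((m : ℤ) : ℂ) * ((π : ℂ) + (π : ℂ) * Complex.I + u)) +
      Complex.exp (-(π : ℂ) * ((-((m : ℤ) + 1) : ℤ) : ℂ) ^ 2
        - ((-((m : ℤ) + 1) : ℤ) : ℂ) * ((π : ℂ) + (π : ℂ) * Complex.I + u)) =
    (-1) ^ m * Complex.exp (-(π : ℂ) * (m ^ 2 + m)) * (1 - Complex.exp u) *
      ∑ k ∈ Finset.range (2 * m + 1), Complex.exp ((k - m) * u) := by
  have hneg : Complex.exp (-(m * (π * Complex.I))) = (-1) ^ m := by
    rw [← mul_neg, Complex.exp_nat_mul, Complex.exp_neg, Complex.exp_pi_mul_I]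
    norm_num
  have hpos : Complex.exp (m * (π * Complex.I)) = (-1) ^ m := by
    rw [Complex.exp_nat_mul, Complex.exp_pi_mul_I]
  have hsum : ∑ k ∈ Finset.range (2 * m + 1), Complex.exp ((k - m) * u) =
      Complex.exp (-(m * u)) * ∑ k ∈ Finset.range (2 * m + 1), Complex.exp u ^ k := by
    rw [Finset.mul_sum]
    refine Finset.sum_congr rfl fun k _ => ?_
    rw [← Complex.exp_nat_mul, ← Complex.exp_add]
    ring_nf
  have hgeom := mul_neg_geom_sum (Complex.exp u) (2 * m + 1)
  have hfst : Complex.exp (-(π : ℂ) * ((m : ℤ) : ℂ) ^ 2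
        - ((m : ℤ) : ℂ) * ((π : ℂ) + (π : ℂ) * Complex.I + u)) =
      (-1) ^ m * Complex.exp (-(π : ℂ) * (m ^ 2 + m)) * Complex.exp (-(m * u)) := by
    rw [← hneg, ← Complex.exp_add, ← Complex.exp_add]
    push_cast
    ring_nf
  have hsnd : Complex.exp (-(π : ℂ) * ((-((m : ℤ) + 1) : ℤ) : ℂ) ^ 2
        - ((-((m : ℤ) + 1) : ℤ) : ℂ) * ((π : ℂ) + (π : ℂ) * Complex.I + u)) =
      -((-1) ^ m * Complex.exp (-(π : ℂ) * (m ^ 2 + m)) * Complex.exp (-(m * u)) *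
        Complex.exp u ^ (2 * m + 1)) := by
    rw [← hpos, ← Complex.exp_nat_mul, ← Complex.exp_add, ← Complex.exp_add, ← Complex.exp_add,
      ← Complex.exp_add_pi_mul_I]
    push_cast
    ring_nf
  rw [hfst, hsnd, hsum]
  linear_combination -((-1) ^ m * Complex.exp (-(π : ℂ) * (m ^ 2 + m)) *
    Complex.exp (-(m * u))) * hgeom

theorem norm_sum_exp_sub_mul_le (m : ℕ) {u : ℂ} (hu : |u.re| ≤ π) :
    ‖∑ k ∈ Finset.range (2 * m + 1), Complex.exp ((k - m) * u)‖ ≤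
      (2 * m + 1) * Real.exp (m * π) := by
  have hterm : ∀ k ∈ Finset.range (2 * m + 1),
      ‖Complex.exp ((k - m) * u)‖ ≤ Real.exp (m * π) := by
    intro k hk
    have hkm : |(k : ℝ) - m| ≤ m := by
      have hk' : (k : ℝ) ≤ 2 * m := by exact_mod_cast Nat.lt_succ_iff.1 (Finset.mem_range.1 hk)
      rw [abs_le]
      constructor <;> linarith [(Nat.cast_nonneg k : (0 : ℝ) ≤ k)]
    have hre : ((k - m) * u : ℂ).re = ((k : ℝ) - m) * u.re := by simp
    rw [Complex.norm_exp, hre, Real.exp_le_exp]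
    calc ((k : ℝ) - m) * u.re ≤ |(k : ℝ) - m| * |u.re| := by
          rw [← abs_mul]; exact le_abs_self _
      _ ≤ m * π := by gcongr
  simpa using norm_sum_le_of_le _ hterm

theorem exp_neg_pi_le : Real.exp (-π) ≤ 1 / 12 := by
  have h : (12 : ℝ) ≤ Real.exp π := by
    calc (12 : ℝ) ≤ 2.7 ^ 3 := by norm_num
      _ ≤ Real.exp 1 ^ 3 := by
          gcongr
          linarith [Real.exp_one_gt_d9]
      _ = Real.exp 3 := by rw [← Real.exp_nat_mul]; norm_num
      _ ≤ Real.exp π := Real.exp_le_exp.2 Real.pi_gt_three.le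
  rw [Real.exp_neg, ← one_div]
  exact one_div_le_one_div_of_le (by norm_num) h

theorem two_mul_add_one_mul_exp_neg_pi_mul_sq_le (m : ℕ) :
    (2 * m + 1) * Real.exp (-π * m ^ 2) ≤ (1 / 4 : ℝ) ^ m := by
  have hbern : (2 * m + 1 : ℝ) ≤ 3 ^ m := by
    have := one_add_mul_le_pow (a := (2 : ℝ)) (by norm_num) m
    norm_num at this
    linarith
  have hexp : Real.exp (-π * m ^ 2) ≤ (1 / 12) ^ m := by
    calc Real.exp (-π * m ^ 2) ≤ Real.exp (m * -π) := by
          have hm : (m : ℝ) ≤ m ^ 2 := by exact_mod_cast Nat.le_self_pow two_ne_zero m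
          rw [Real.exp_le_exp]
          nlinarith [Real.pi_pos]
      _ = Real.exp (-π) ^ m := Real.exp_nat_mul _ _
      _ ≤ (1 / 12) ^ m := by gcongr; exact exp_neg_pi_le
  calc (2 * m + 1) * Real.exp (-π * m ^ 2) ≤ 3 ^ m * (1 / 12) ^ m := by gcongr
    _ = (1 / 4 : ℝ) ^ m := by rw [← mul_pow]; norm_num

theorem norm_thetaLike_sub_le {u : ℂ} (hu : |u.re| ≤ π) :
    ‖thetaLike ((π : ℂ) + (π : ℂ) * Complex.I + u) - (1 - Complex.exp u)‖ ≤
      1 / 3 * ‖1 - Complex.exp u‖ := by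
  have hsum := (summable_thetaLike_term ((π : ℂ) + (π : ℂ) * Complex.I + u)).hasSum.nat_add_neg_add_one
  simp_rw [thetaLike_term_add_reflected_term] at hsum
  change HasSum _ (thetaLike _) at hsum
  have htail := (hasSum_nat_add_iff' 1).2 hsum
  have hgeom : HasSum (fun m : ℕ => ‖1 - Complex.exp u‖ * (1 / 4 : ℝ) ^ (m + 1))
      (1 / 3 * ‖1 - Complex.exp u‖) := by
    have h := (hasSum_geometric_of_lt_one (r := (1 / 4 : ℝ)) (by norm_num) (by norm_num)).mul_left
      (‖1 - Complex.exp u‖ * (1 / 4))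
    rw [show ‖1 - Complex.exp u‖ * (1 / 4) * (1 - 1 / 4)⁻¹ = 1 / 3 * ‖1 - Complex.exp u‖ by
      norm_num
      ring] at h
    simpa only [pow_succ', mul_assoc] using h
  have hterm : ∀ m : ℕ, ‖(-1) ^ (m + 1) * Complex.exp (-(π : ℂ) * (((m + 1 : ℕ) : ℂ) ^ 2 +
      ((m + 1 : ℕ) : ℂ))) * (1 - Complex.exp u) * ∑ k ∈ Finset.range (2 * (m + 1) + 1),
        Complex.exp ((k - ((m + 1 : ℕ) : ℂ)) * u)‖ ≤ ‖1 - Complex.exp u‖ * (1 / 4 : ℝ) ^ (m + 1) := by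
    intro m
    set n := m + 1
    have hnorm : ‖Complex.exp (-(π : ℂ) * ((n : ℂ) ^ 2 + n))‖ =
        Real.exp (-π * n ^ 2) * Real.exp (-(n * π)) := by
      rw [← Real.exp_add, Complex.norm_exp]
      congr 1
      rw [show -(π : ℂ) * ((n : ℂ) ^ 2 + n) = ((-π * (n ^ 2 + n) : ℝ) : ℂ) by push_cast; ring,
        Complex.ofReal_re]
      ring
    rw [norm_mul, norm_mul, norm_mul, norm_pow, norm_neg, norm_one, one_pow, one_mul, hnorm]
    calc _ ≤ Real.exp (-π * n ^ 2) * Real.exp (-(n * π)) * ‖1 - Complex.exp u‖ *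
          ((2 * n + 1) * Real.exp (n * π)) := by
          gcongr
          exact norm_sum_exp_sub_mul_le n hu
      _ = ‖1 - Complex.exp u‖ * ((2 * n + 1) * Real.exp (-π * n ^ 2)) *
          (Real.exp (-(n * π)) * Real.exp (n * π)) := by ring
      _ = ‖1 - Complex.exp u‖ * ((2 * n + 1) * Real.exp (-π * n ^ 2)) := by
          rw [← Real.exp_add, neg_add_cancel, Real.exp_zero, mul_one]
      _ ≤ ‖1 - Complex.exp u‖ * (1 / 4 : ℝ) ^ n := by
          gcongr
          exact two_mul_add_one_mul_exp_neg_pi_mul_sq_le n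
  simpa using htail.norm_le_of_bounded hgeom hterm

theorem norm_one_sub_exp_le_thetaLike {u : ℂ} (hu : |u.re| ≤ π) :
    ‖1 - Complex.exp u‖ ≤ 3 / 2 * ‖thetaLike ((π : ℂ) + (π : ℂ) * Complex.I + u)‖ := by
  have h := norm_thetaLike_sub_le hu
  rw [norm_sub_rev] at h
  linarith [norm_sub_norm_le (1 - Complex.exp u)
    (thetaLike ((π : ℂ) + (π : ℂ) * Complex.I + u))]

theorem thetaLike_pi_add_pi_mul_I : thetaLike ((π : ℂ) + (π : ℂ) * Complex.I) = 0 := by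
  simpa using norm_thetaLike_sub_le (u := 0) (by simpa using Real.pi_pos.le)

theorem deriv_thetaLike_pi_add_pi_mul_I_ne_zero :
    deriv thetaLike ((π : ℂ) + (π : ℂ) * Complex.I) ≠ 0 := by
  intro hderiv
  have hθ : HasDerivAt (fun u => thetaLike ((π : ℂ) + (π : ℂ) * Complex.I + u)) 0 0 := by
    have h := (differentiable_thetaLike ((π : ℂ) + (π : ℂ) * Complex.I)).hasDerivAt
    rw [hderiv] at h
    exact HasDerivAt.comp_const_add _ 0 (by simpa using h)
  have hexp : HasDerivAt (fun u => 1 - Complex.exp u) 0 0 := by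
    rw [hasDerivAt_iff_isLittleO] at hθ ⊢
    refine Asymptotics.IsBigO.trans_isLittleO (Asymptotics.IsBigO.of_bound (3 / 2) ?_) hθ
    have hre : ∀ᶠ u : ℂ in nhds 0, |u.re| < π :=
      (by fun_prop : Continuous fun u : ℂ => |u.re|).continuousAt.eventually_lt
        continuousAt_const (by simpa using Real.pi_pos)
    filter_upwards [hre] with u hu
    simpa [thetaLike_pi_add_pi_mul_I] using norm_one_sub_exp_le_thetaLike hu.le
  have := hexp.unique ((Complex.hasDerivAt_exp 0).const_sub 1)
  simp at this

theorem eq_pi_add_pi_mul_I_of_thetaLike_eq_zero {z : ℂ} (hre : z.re ∈ Set.Ico 0 (2 * π))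
    (him : z.im ∈ Set.Ico 0 (2 * π)) (hz : thetaLike z = 0) :
    z = (π : ℂ) + (π : ℂ) * Complex.I := by
  set u := z - ((π : ℂ) + (π : ℂ) * Complex.I) with hu
  have hzu : (π : ℂ) + (π : ℂ) * Complex.I + u = z := by rw [hu]; ring
  have hure : u.re = z.re - π := by simp [hu]
  have huim : u.im = z.im - π := by simp [hu]
  have hbound : |u.re| ≤ π := by
    rw [hure, abs_le]
    constructor <;> linarith [hre.1, hre.2]
  have hnorm := norm_one_sub_exp_le_thetaLike hbound
  rw [hzu, hz, norm_zero, mul_zero, norm_le_zero_iff, sub_eq_zero] at hnorm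
  have hu0 : u = 0 := by
    rw [← neg_eq_zero]
    refine Complex.exp_inj_of_neg_pi_lt_of_le_pi ?_ ?_ ?_ ?_ ?_
    · rw [Complex.neg_im]
      linarith [him.2]
    · rw [Complex.neg_im]
      linarith [him.1]
    · simpa using Real.pi_pos
    · simpa using Real.pi_pos.le
    · rw [Complex.exp_neg, ← hnorm, Complex.exp_zero, inv_one]
  rw [← hzu, hu0, add_zero]

/-- **Zeros of the theta-like function.**  Let `f(z) = Σ_{n∈ℤ} e^{−πn²−nz}` (the series
converges absolutely for every `z`, and `f` is entire).  Then: (i) `f(z+2πi) = f(z)` and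
`f(z+2π) = e^{z+π} f(z)`; (ii) `f` has exactly one zero, counted with multiplicity, in the
fundamental square `{x+iy : 0 ≤ x < 2π, 0 ≤ y < 2π}`, namely a simple zero at
`z = π + iπ`. -/
theorem thetaLike_periodicity_and_unique_zero :
    (∀ z : ℂ, Summable fun n : ℤ => Complex.exp (-(π : ℂ) * (n : ℂ) ^ 2 - (n : ℂ) * z)) ∧
    Differentiable ℂ thetaLike ∧
    (∀ z : ℂ, thetaLike (z + 2 * (π : ℂ) * Complex.I) = thetaLike z) ∧
    (∀ z : ℂ, thetaLike (z + 2 * (π : ℂ)) = Complex.exp (z + (π : ℂ)) * thetaLike z) ∧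
    thetaLike ((π : ℂ) + (π : ℂ) * Complex.I) = 0 ∧
    deriv thetaLike ((π : ℂ) + (π : ℂ) * Complex.I) ≠ 0 ∧
    (∀ z : ℂ, z.re ∈ Set.Ico 0 (2 * π) → z.im ∈ Set.Ico 0 (2 * π) →
      thetaLike z = 0 → z = (π : ℂ) + (π : ℂ) * Complex.I) := by
  exact ⟨summable_thetaLike_term, differentiable_thetaLike, thetaLike_add_two_pi_mul_I,
    thetaLike_add_two_pi, thetaLike_pi_add_pi_mul_I, deriv_thetaLike_pi_add_pi_mul_I_ne_zero,
    fun _ => eq_pi_add_pi_mul_I_of_thetaLike_eq_zero⟩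
end
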